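/- For m, n ≥ 0 define u_{m,n}(x) = exp(−x⁴/12 + (m − n)x²/2)·h_{m,n}(x), where h_{m,n}(x) = S_{(n^m)}(x, 1/6). Then for all m, n ≥ 0 the following hold identically in x: (D_x² − x·D_x + (m + 2n + 1)) u_{m,n+1}·u_{m,n} = 0; (D_x² − x·D_x + (m − n)) u_{m+1,n}·u_{m,n+1} = 0; and (D_x² − x·D_x − (2m + n + 1)) u_{m,n}·u_{m+1,n} = 0. Consequently the triple (τ0, τ1, τ2) = (u_{m,n}, u_{m+1,n}, u_{m,n+1}) satisfies the bilinear form of the fourth Painlevé equation (D_x² − x·D_x − (α_i − α_{i+1})/3) τ_i·τ_{i+1} = 0 (i mod 3) with parameters (α0, α1, α2) = (3(m + n + 1), −3m, −3n). -/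

import Mathlib

/-- `p2 c n` is the two-variable polynomial `p_n(t₁, t₂) = ∑_{i+2j=n} t₁^i t₂^j/(i!·j!)`
with the second variable specialized to `t₂ = c`, as a polynomial in `x = t₁`. -/
noncomputable def p2 (c : ℂ) (n : ℕ) : Polynomial ℂ :=
  ∑ j ∈ Finset.range (n / 2 + 1),
    Polynomial.C (c ^ j / ((Nat.factorial (n - 2 * j) : ℂ) * (Nat.factorial j : ℂ))) *
      Polynomial.X ^ (n - 2 * j)

/-- `p_m(x, c)` for an integer index, with `p_m = 0` for `m < 0`. -/
noncomputable def p2Z (c : ℂ) (m : ℤ) : Polynomial ℂ :=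
  if 0 ≤ m then p2 c m.toNat else 0

/-- `hRect m n` is the polynomial `h_{m,n}(x) = S_{(nᵐ)}(x, 1/6)`: the Jacobi–Trudi
determinant `det(p_{n−i+j}(x, 1/6))_{1≤i,j≤m}` of the rectangular partition `(nᵐ)`
with `m` parts equal to `n`. -/
noncomputable def hRect (m n : ℕ) : Polynomial ℂ :=
  Matrix.det (Matrix.of fun i j : Fin m =>
    p2Z (1 / 6) ((n : ℤ) - (i : ℕ) + (j : ℕ)))

/-- `uFun m n` is the function `u_{m,n}(x) = exp(−x⁴/12 + (m−n)x²/2)·h_{m,n}(x)`. -/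
noncomputable def uFun (m n : ℕ) : ℝ → ℂ := fun x : ℝ =>
  Complex.exp (-(x : ℂ) ^ 4 / 12 + ((m : ℂ) - (n : ℂ)) * (x : ℂ) ^ 2 / 2) *
    (hRect m n).eval (x : ℂ)

/-- The Hirota bilinear expression `((Dₓ² − x·Dₓ + c) F·G)(x)` for functions `ℝ → ℂ`. -/
noncomputable def hirotaFun (c : ℂ) (F G : ℝ → ℂ) (x : ℝ) : ℂ :=
  deriv (deriv F) x * G x - 2 * deriv F x * deriv G x + F x * deriv (deriv G) x -
    x * (deriv F x * G x - F x * deriv G x) + c * (F x * G x)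

open Polynomial in
theorem p2Z_coeff_add_two_mul (c : ℂ) (a j : ℕ) :
    (p2Z c ((a : ℤ) + 2 * j)).coeff a = c ^ j / ((a.factorial : ℂ) * (j.factorial : ℂ)) := by
  have h : ((a : ℤ) + 2 * j).toNat = a + 2 * j := by omega
  rw [p2Z, if_pos (by positivity), h, p2, finsetSum_coeff,
    Finset.sum_eq_single_of_mem j (by simp; omega)]
  · simp
  · intro b hb hbj
    rw [Finset.mem_range] at hb
    rw [coeff_C_mul, coeff_X_pow, if_neg (by omega), mul_zero]

open Polynomial in
theorem p2Z_coeff_eq_zero (c : ℂ) (k : ℤ) (a : ℕ) (h : ∀ j : ℕ, k ≠ a + 2 * j) :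
    (p2Z c k).coeff a = 0 := by
  rw [p2Z]
  split_ifs with hk
  · rw [p2, finsetSum_coeff]
    refine Finset.sum_eq_zero fun b hb => ?_
    rw [Finset.mem_range] at hb
    have := h b
    rw [coeff_C_mul, coeff_X_pow, if_neg (by omega), mul_zero]
  · simp

open Polynomial in
theorem derivative_p2Z (c : ℂ) (k : ℤ) : derivative (p2Z c k) = p2Z c (k - 1) := by
  ext a
  rw [coeff_derivative]
  by_cases h : ∃ j : ℕ, k = a + 1 + 2 * j
  · obtain ⟨j, rfl⟩ := h
    have h1 := p2Z_coeff_add_two_mul c (a + 1) j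
    push_cast at h1
    rw [h1, show (a : ℤ) + 1 + 2 * j - 1 = a + 2 * j by ring, p2Z_coeff_add_two_mul,
      Nat.factorial_succ]
    have := Nat.factorial_ne_zero a
    have := Nat.factorial_ne_zero j
    have : (a : ℂ) + 1 ≠ 0 := by exact_mod_cast a.succ_ne_zero
    push_cast
    field_simp
  · push Not at h
    rw [p2Z_coeff_eq_zero c k (a + 1) (by exact_mod_cast h),
      p2Z_coeff_eq_zero c (k - 1) a (fun j => by have := h j; omega), zero_mul]

open Polynomial in
theorem p2Z_recurrence (c : ℂ) (k : ℤ) :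
    (k : ℂ[X]) * p2Z c k = X * p2Z c (k - 1) + C (2 * c) * p2Z c (k - 2) := by
  ext a
  have hX : (X * p2Z c (k - 1)).coeff a = a * (p2Z c k).coeff a := by
    rw [← derivative_p2Z]
    cases a with
    | zero => simp
    | succ a => rw [coeff_X_mul, coeff_derivative]; push_cast; ring
  rw [coeff_add, hX, coeff_C_mul, coeff_intCast_mul]
  by_cases h : ∃ j : ℕ, k = a + 2 * j
  · obtain ⟨j, rfl⟩ := h
    cases j with
    | zero =>
      rw [p2Z_coeff_eq_zero c (_ - 2) a (fun j => by omega)]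
      simp
    | succ j =>
      rw [show (a : ℤ) + 2 * (j + 1 : ℕ) - 2 = a + 2 * j by push_cast; ring,
        p2Z_coeff_add_two_mul, p2Z_coeff_add_two_mul, Nat.factorial_succ]
      have := Nat.factorial_ne_zero a
      have := Nat.factorial_ne_zero j
      have : (j : ℂ) + 1 ≠ 0 := by exact_mod_cast j.succ_ne_zero
      push_cast
      field_simp
      ring
  · push Not at h
    rw [p2Z_coeff_eq_zero c k a h,
      p2Z_coeff_eq_zero c (k - 2) a (fun j => by have := h (j + 1); push_cast at this; omega)]
    simp

theorem p2Z_zero (c : ℂ) : p2Z c 0 = 1 := by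
  simp [p2Z, p2]

theorem p2Z_of_neg (c : ℂ) {k : ℤ} (hk : k < 0) : p2Z c k = 0 := by
  rw [p2Z, if_neg (by omega)]

namespace Matrix

variable {ι R : Type*} [Fintype ι] [DecidableEq ι] [CommRing R]

theorem sum_det_updateRow (M V : Matrix ι ι R) :
    ∑ i, (M.updateRow i (V i)).det = (V * M.adjugate).trace := by
  refine Finset.sum_congr rfl fun i _ => ?_
  rw [← cramer_transpose_apply, cramer_eq_adjugate_mulVec, ← adjugate_transpose]
  simp [mulVec, dotProduct, mul_apply, mul_comm]

theorem sum_det_updateRow_mul_left (M : Matrix ι ι R) (d : ι → R) :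
    ∑ i, (M.updateRow i (fun j => d i * M i j)).det = (∑ i, d i) * M.det := by
  rw [Finset.sum_mul]
  refine Finset.sum_congr rfl fun i _ => ?_
  have : (fun j => d i * M i j) = d i • M i := rfl
  rw [this, det_updateRow_smul, updateRow_eq_self]

theorem sum_det_updateRow_mul_right (M : Matrix ι ι R) (d : ι → R) :
    ∑ i, (M.updateRow i (fun j => d j * M i j)).det = (∑ j, d j) * M.det := by
  have h : (of fun i j => d j * M i j) = M * diagonal d := by
    ext i j
    simp [mul_comm]
  have := sum_det_updateRow M (of fun i j => d j * M i j)
  rw [h, trace_mul_comm, ← Matrix.mul_assoc, adjugate_mul, smul_mul_assoc, Matrix.one_mul,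
    trace_smul, trace_diagonal, smul_eq_mul, mul_comm] at this
  rw [← this]
  refine Finset.sum_congr rfl fun i _ => ?_
  rw [← h]
  rfl

open Polynomial in
theorem derivative_det (M : Matrix ι ι R[X]) :
    derivative M.det = ∑ i, (M.updateRow i (fun j => derivative (M i j))).det := by
  have h (A : Matrix ι ι R[X]) :
      A.det = ∑ σ : Equiv.Perm ι, Equiv.Perm.sign σ • ∏ i, A i (σ i) := by
    rw [← det_transpose, det_apply]
    rfl
  simp_rw [h]
  rw [derivative_sum, Finset.sum_comm]
  refine Finset.sum_congr rfl fun σ _ => ?_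
  rw [Units.smul_def, derivative_smul, derivative_prod_finset, Finset.smul_sum]
  refine Finset.sum_congr rfl fun i _ => ?_
  rw [Units.smul_def, ← Finset.prod_erase_mul _ _ (Finset.mem_univ i), updateRow_self]
  congr 2
  refine Finset.prod_congr rfl fun j hj => ?_
  rw [updateRow_ne (Finset.ne_of_mem_erase hj)]

end Matrix

namespace Matrix

variable {R : Type*} [CommRing R]

/-- The square matrix made of the first `N` terms of a sequence of row vectors. -/
def ofRowSeq {N : ℕ} (W : ℕ → Fin N → R) : Matrix (Fin N) (Fin N) R :=
  of fun i j => W i j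

/-- The sum of the determinants obtained from `ofRowSeq W` by moving one row two steps
forward in the sequence. -/
def detRowShiftTwo {N : ℕ} (W : ℕ → Fin N → R) : R :=
  ∑ i : Fin N, ((ofRowSeq W).updateRow i (W (i + 2))).det

theorem det_updateRow_ofRowSeq_eq_zero {N : ℕ} (W : ℕ → Fin N → R) (i : Fin N) {k : ℕ}
    (hk : k < N) (hki : k ≠ i) : ((ofRowSeq W).updateRow i (W k)).det = 0 := by
  have h : (⟨k, hk⟩ : Fin N) ≠ i := fun h => hki (congrArg Fin.val h)
  refine det_zero_of_row_eq h ?_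
  rw [updateRow_ne h, updateRow_self]
  rfl

theorem detRowShiftTwo_add_two {k : ℕ} (W : ℕ → Fin (k + 2) → R) :
    detRowShiftTwo W =
      ((ofRowSeq W).updateRow (Fin.last k).castSucc (W (k + 2))).det +
        ((ofRowSeq W).updateRow (Fin.last (k + 1)) (W (k + 3))).det := by
  rw [detRowShiftTwo, Fin.sum_univ_castSucc, Fin.sum_univ_castSucc, Finset.sum_eq_zero, zero_add]
  · rfl
  · intro i _
    exact det_updateRow_ofRowSeq_eq_zero W _ (by simp) (by simp)

open Polynomial in
theorem derivative_det_ofRowSeq {k : ℕ} {W : ℕ → Fin (k + 1) → R[X]}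
    (hW : ∀ i j, derivative (W i j) = W (i + 1) j) :
    derivative (ofRowSeq W).det =
      ((ofRowSeq W).updateRow (Fin.last k) (W (k + 1))).det := by
  have hrow (i : Fin (k + 1)) : (fun j => derivative (ofRowSeq W i j)) = W (i + 1) :=
    funext fun j => hW i j
  simp_rw [derivative_det, hrow]
  rw [Fin.sum_univ_castSucc, Finset.sum_eq_zero, zero_add]
  · rfl
  · intro i _
    exact det_updateRow_ofRowSeq_eq_zero W _ (by simp) (by simp)

theorem det_updateRow_updateRow_ofRowSeq {k : ℕ} (W : ℕ → Fin (k + 1) → R) (i : Fin k) :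
    (((ofRowSeq W).updateRow (Fin.last k) (W (k + 1))).updateRow i.castSucc (W (i + 1))).det =
      -((ofRowSeq W).updateRow i.castSucc (W (i + 2))).det := by
  have hne : i.castSucc ≠ Fin.last k := i.castSucc_lt_last.ne
  rcases Nat.lt_or_ge (i + 1) k with hi | hi
  · rw [det_updateRow_ofRowSeq_eq_zero W i.castSucc (k := i + 2) (by omega) (by simp), neg_zero]
    have h1 : i.castSucc ≠ (⟨i + 1, by omega⟩ : Fin (k + 1)) := by simp [Fin.ext_iff]
    have h2 : (⟨i + 1, by omega⟩ : Fin (k + 1)) ≠ Fin.last k := by simp [Fin.ext_iff]; omega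
    refine det_zero_of_row_eq h1 ?_
    rw [updateRow_self, updateRow_ne h1.symm, updateRow_ne h2]
    rfl
  · have hk : (i : ℕ) + 1 = k := by omega
    have hk' : (i : ℕ) + 2 = k + 1 := by omega
    have := det_permute (Equiv.swap i.castSucc (Fin.last k))
      ((ofRowSeq W).updateRow i.castSucc (W (i + 2)))
    rw [Equiv.Perm.sign_swap hne, Units.val_neg, Units.val_one, Int.cast_neg, Int.cast_one,
      neg_one_mul] at this
    rw [← this, hk, hk']
    congr 1
    ext a b
    rw [submatrix_apply, id_eq]
    by_cases ha : a = i.castSucc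
    · rw [ha, updateRow_self, Equiv.swap_apply_left, updateRow_ne hne.symm]
      rfl
    · rw [updateRow_ne ha]
      by_cases ha' : a = Fin.last k
      · rw [ha', updateRow_self, Equiv.swap_apply_right, updateRow_self]
      · rw [updateRow_ne ha', Equiv.swap_apply_of_ne_of_ne ha ha', updateRow_ne ha]

open Polynomial in
theorem derivative_derivative_det_ofRowSeq {k : ℕ} {W : ℕ → Fin (k + 1) → R[X]}
    (hW : ∀ i j, derivative (W i j) = W (i + 1) j) :
    derivative (derivative (ofRowSeq W).det) + detRowShiftTwo W =
      2 * ((ofRowSeq W).updateRow (Fin.last k) (W (k + 2))).det := by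
  have hlast : (fun j => derivative
      ((ofRowSeq W).updateRow (Fin.last k) (W (k + 1)) (Fin.last k) j)) = W (k + 2) := by
    ext1 j
    rw [updateRow_self, hW]
  have hrow (i : Fin k) : (fun j => derivative
      ((ofRowSeq W).updateRow (Fin.last k) (W (k + 1)) i.castSucc j)) = W (i + 1) := by
    ext1 j
    rw [updateRow_ne i.castSucc_lt_last.ne]
    exact hW i j
  rw [derivative_det_ofRowSeq hW, derivative_det, detRowShiftTwo, Fin.sum_univ_castSucc,
    Fin.sum_univ_castSucc, hlast, updateRow_idem]
  simp_rw [hrow, det_updateRow_updateRow_ofRowSeq]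
  rw [Finset.sum_neg_distrib]
  simp only [Fin.val_castSucc, Fin.val_last]
  ring

/-- A three-term Plücker relation between the maximal minors of a sequence of row vectors and
those of the vectors with one coordinate fewer. -/
theorem det_ofRowSeq_mul_det_updateRow {k : ℕ} (W : ℕ → Fin (k + 2) → R)
    (s : Fin (k + 1) → Fin (k + 2)) :
    (ofRowSeq W).det *
        ((ofRowSeq fun i j => W i (s j)).updateRow (Fin.last k) fun j => W (k + 2) (s j)).det =
      ((ofRowSeq W).updateRow (Fin.last k).castSucc (W (k + 2))).det *
          (ofRowSeq fun i j => W i (s j)).det +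
        ((ofRowSeq W).updateRow (Fin.last (k + 1)) (W (k + 2))).det *
          ((ofRowSeq fun i j => W i (s j)).updateRow (Fin.last k) fun j => W (k + 1) (s j)).det := by
  set F := ofRowSeq fun i j => W i (s j) with hF
  let L : (Fin (k + 2) → R) →ₗ[R] R :=
    { toFun v := (F.updateRow (Fin.last k) fun j => v (s j)).det
      map_add' u v := det_updateRow_add F (Fin.last k) (fun j => u (s j)) fun j => v (s j)
      map_smul' r v := det_updateRow_smul F (Fin.last k) r fun j => v (s j) }
  have hcramer : (ofRowSeq W).det • W (k + 2) =
      ∑ i : Fin (k + 2), ((ofRowSeq W).updateRow i (W (k + 2))).det • W i := by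
    rw [← det_transpose, ← mulVec_cramer]
    ext j
    simp only [mulVec, dotProduct, Finset.sum_apply, Pi.smul_apply, smul_eq_mul,
      cramer_transpose_apply]
    exact Finset.sum_congr rfl fun i _ => mul_comm _ _
  have h := congrArg L hcramer
  simp only [map_smul, map_sum, smul_eq_mul] at h
  rw [Fin.sum_univ_castSucc, Fin.sum_univ_castSucc, Finset.sum_eq_zero, zero_add] at h
  · have hfix : L (W k) = F.det := congrArg det (updateRow_eq_self F (Fin.last k))
    simp only [Fin.val_castSucc, Fin.val_last, hfix] at h
    exact h
  · intro i _
    have : L (W i) = 0 := det_updateRow_ofRowSeq_eq_zero (fun i j => W i (s j)) (Fin.last k)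
      (k := i) (by omega) (by simpa using i.isLt.ne)
    simp only [Fin.val_castSucc, this, mul_zero]

open Polynomial in
/-- The bilinear relation between a Wronskian determinant and the one with one more function,
when a second derivation acts on all the functions as the second derivative. -/
theorem bilinear_det_ofRowSeq {m : ℕ} {W : ℕ → Fin (m + 1) → R[X]}
    (hW : ∀ i j, derivative (W i j) = W (i + 1) j) (s : Fin m → Fin (m + 1))
    {f g : R[X]} (hf : f = (ofRowSeq fun i j => W i (s j)).det) (hg : g = (ofRowSeq W).det) :
    derivative (derivative f) * g - 2 * derivative f * derivative g +
      f * derivative (derivative g) + detRowShiftTwo (fun i j => W i (s j)) * g -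
      f * detRowShiftTwo W = 0 := by
  subst hf hg
  have hG2 := derivative_derivative_det_ofRowSeq hW
  cases m with
  | zero =>
    have hF : detRowShiftTwo (fun i j => W i (s j)) = 0 := by simp [detRowShiftTwo]
    have hF' : (ofRowSeq fun i j => W i (s j)).det = 1 := det_isEmpty
    have hG : detRowShiftTwo W = ((ofRowSeq W).updateRow (Fin.last 0) (W 2)).det := by
      simp [detRowShiftTwo]
    rw [hF, hF', derivative_one, derivative_zero]
    linear_combination hG2 - 2 * hG
  | succ k =>
    have hWs : ∀ i j, derivative (W i (s j)) = W (i + 1) (s j) := fun i j => hW i (s j)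
    have hF2 := derivative_derivative_det_ofRowSeq hWs
    have hF1 := derivative_det_ofRowSeq hWs
    have hG1 := derivative_det_ofRowSeq hW
    have hG := detRowShiftTwo_add_two W
    have hP := det_ofRowSeq_mul_det_updateRow W s
    rw [← hF1, ← hG1] at hP
    linear_combination (ofRowSeq W).det * hF2 + 2 * hP +
      (ofRowSeq fun i j => W i (s j)).det * (hG2 - 2 * hG)

end Matrix

/-- The sequence of rows with entries `p_{c_j - i}(x, 1/6)`; each row is the derivative of the
preceding one. -/
noncomputable def p2Rows {N : ℕ} (c : Fin N → ℤ) (i : ℕ) (j : Fin N) : Polynomial ℂ :=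
  p2Z (1 / 6) (c j - i)

open Polynomial in
theorem derivative_p2Rows {N : ℕ} (c : Fin N → ℤ) (i : ℕ) (j : Fin N) :
    derivative (p2Rows c i j) = p2Rows c (i + 1) j := by
  rw [p2Rows, p2Rows, derivative_p2Z]
  push_cast
  rw [sub_sub]

open Polynomial Matrix in
theorem detRowShiftTwo_p2Rows {N : ℕ} (c : Fin N → ℤ) :
    detRowShiftTwo (p2Rows c) =
      3 * ((((∑ j, c j : ℤ) : ℂ[X]) - ∑ i ∈ Finset.range N, (i : ℂ[X])) * (ofRowSeq (p2Rows c)).det -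
        X * derivative (ofRowSeq (p2Rows c)).det) := by
  set M := ofRowSeq (p2Rows c) with hM
  have hrow (i : Fin N) : p2Rows c (i + 2) =
      (3 : ℂ[X]) • (fun j => (c j : ℂ[X]) * M i j) +
        ((-3 : ℂ[X]) • (fun j => ((i : ℕ) : ℂ[X]) * M i j) +
          (-3 * X : ℂ[X]) • fun j => derivative (M i j)) := by
    ext1 j
    have h := p2Z_recurrence (1 / 6) (c j - (i : ℕ))
    have h2 : p2Rows c (i + 2) j = p2Z (1 / 6) (c j - (i : ℕ) - 2) := by
      rw [p2Rows]; push_cast; rw [sub_sub]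
    have h3 : (3 : ℂ[X]) * C (2 * (1 / 6)) = 1 := by
      rw [show (3 : ℂ[X]) = C 3 from rfl, ← C_mul, ← C_1]; norm_num
    have h4 : M i j = p2Z (1 / 6) (c j - (i : ℕ)) := rfl
    simp only [Pi.add_apply, Pi.smul_apply, smul_eq_mul]
    rw [h2, h4, derivative_p2Z]
    push_cast at h
    linear_combination (-3 : ℂ[X]) * h - p2Z (1 / 6) (c j - (i : ℕ) - 2) * h3
  simp_rw [detRowShiftTwo, hrow, det_updateRow_add, det_updateRow_smul, Finset.sum_add_distrib,
    ← Finset.mul_sum]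
  rw [← hM, ← derivative_det, sum_det_updateRow_mul_right M fun j => (c j : ℂ[X]),
    sum_det_updateRow_mul_left M fun i => ((i : ℕ) : ℂ[X]), ← Fin.sum_univ_eq_sum_range]
  push_cast
  ring

open Polynomial Matrix in
theorem bilinear_det_p2Rows {m : ℕ} (c : Fin (m + 1) → ℤ) (s : Fin m → Fin (m + 1)) {d : ℤ}
    (hd : ∑ j, c (s j) - ∑ j, c j + m = d) {f g : ℂ[X]}
    (hf : f = (ofRowSeq (p2Rows fun j => c (s j))).det) (hg : g = (ofRowSeq (p2Rows c)).det) :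
    derivative (derivative f) * g - 2 * derivative f * derivative g +
      f * derivative (derivative g) - 3 * X * (derivative f * g - f * derivative g) +
      3 * (d : ℂ[X]) * (f * g) = 0 := by
  have h := bilinear_det_ofRowSeq (derivative_p2Rows c) s hf hg
  have hF := detRowShiftTwo_p2Rows fun j => c (s j)
  have hG := detRowShiftTwo_p2Rows c
  rw [← hf] at hF
  rw [← hg, Finset.sum_range_succ] at hG
  change _ + detRowShiftTwo (p2Rows fun j => c (s j)) * g - _ = 0 at h
  rw [← hd]
  push_cast at hF hG ⊢
  linear_combination h - g * hF + f * hG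

open Matrix in
theorem hRect_eq_det (m n : ℕ) : hRect m n = (ofRowSeq (p2Rows fun j : Fin m => (n : ℤ) + j)).det := by
  rw [hRect]
  congr 1
  ext1 i j
  exact congrArg (p2Z (1 / 6)) (sub_add_eq_add_sub _ _ _)

open Matrix in
theorem hRect_eq_det_cons (m n : ℕ) : hRect m n =
    (ofRowSeq (p2Rows (Fin.cons 0 fun j : Fin m => (n : ℤ) + 1 + j))).det := by
  rw [hRect_eq_det, det_succ_column_zero, Fin.sum_univ_succ, Finset.sum_eq_zero, add_zero]
  · have h1 : ofRowSeq (p2Rows (Fin.cons 0 fun j : Fin m => (n : ℤ) + 1 + j)) 0 0 = 1 := by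
      simp [ofRowSeq, p2Rows, p2Z_zero]
    rw [h1, Fin.val_zero, pow_zero, one_mul, one_mul]
    congr 1
    ext1 i j
    simp only [submatrix_apply, ofRowSeq, of_apply, p2Rows, Fin.succAbove_zero, Fin.cons_succ,
      Fin.val_succ]
    congr 1
    push_cast
    ring
  · intro i _
    have h0 : ofRowSeq (p2Rows (Fin.cons 0 fun j : Fin m => (n : ℤ) + 1 + j)) i.succ 0 = 0 := by
      simp only [ofRowSeq, of_apply, p2Rows, Fin.cons_zero]
      exact p2Z_of_neg (1 / 6) (by simp only [Fin.val_succ]; omega)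
    rw [h0, mul_zero, zero_mul]

open Polynomial in
theorem deriv_cexp_eval_mul_eval (Q P : ℂ[X]) :
    deriv (fun x : ℝ => Complex.exp (Q.eval (x : ℂ)) * P.eval (x : ℂ)) =
      fun x : ℝ => Complex.exp (Q.eval (x : ℂ)) *
        (derivative P + derivative Q * P).eval (x : ℂ) := by
  funext x
  have h := (((Q.hasDerivAt (x : ℂ)).cexp).mul (P.hasDerivAt (x : ℂ))).comp_ofReal
  refine h.deriv.trans ?_
  simp only [eval_add, eval_mul]
  ring

open Polynomial in
/-- The exponent `-x⁴/12 + (m - n)x²/2` of `uFun m n` as a polynomial. -/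
noncomputable def uExponent (m n : ℕ) : ℂ[X] :=
  C (-1 / 12) * X ^ 4 + C (((m : ℂ) - n) / 2) * X ^ 2

open Polynomial in
theorem derivative_uExponent (m n : ℕ) :
    derivative (uExponent m n) = C (-1 / 3) * X * X ^ 2 + C ((m : ℂ) - n) * X := by
  rw [uExponent, derivative_add, derivative_C_mul_X_pow, derivative_C_mul_X_pow, mul_assoc,
    ← pow_succ']
  norm_num

open Polynomial in
theorem hirotaFun_uFun (c : ℂ) (m n m' n' : ℕ) (x : ℝ) :
    hirotaFun c (uFun m n) (uFun m' n') x =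
      Complex.exp ((uExponent m n).eval (x : ℂ)) * Complex.exp ((uExponent m' n').eval (x : ℂ)) *
      ((derivative (derivative (hRect m n)) * hRect m' n' -
        2 * derivative (hRect m n) * derivative (hRect m' n') +
        hRect m n * derivative (derivative (hRect m' n'))).eval (x : ℂ) +
        (2 * ((m : ℂ) - n - (m' - n')) - 1) * x * (derivative (hRect m n) * hRect m' n' -
          hRect m n * derivative (hRect m' n')).eval (x : ℂ) +
        ((((m : ℂ) - n - (m' - n')) ^ 2 - ((m : ℂ) - n - (m' - n')) - 2) * x ^ 2 +
          ((m : ℂ) - n + (m' - n')) + c) * (hRect m n * hRect m' n').eval (x : ℂ)) := by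
  have hu (m n : ℕ) : uFun m n = fun x : ℝ =>
      Complex.exp ((uExponent m n).eval (x : ℂ)) * (hRect m n).eval (x : ℂ) := by
    funext x
    simp only [uFun, uExponent, eval_add, eval_mul, eval_C, eval_pow, eval_X]
    congr 2
    ring
  simp only [hirotaFun, hu, deriv_cexp_eval_mul_eval]
  simp only [derivative_uExponent, derivative_add, derivative_mul, derivative_C,
    derivative_X_pow, derivative_X, eval_add, eval_sub, eval_mul, eval_C, eval_pow, eval_X,
    eval_ofNat, eval_zero, eval_one]
  push_cast
  ring

/-- **Bilinear equations for `u_{m,n} = exp(−x⁴/12 + (m−n)x²/2)·h_{m,n}`:** for all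
`m, n ≥ 0`, `(Dₓ² − x Dₓ + (m+2n+1)) u_{m,n+1}·u_{m,n} = 0`,
`(Dₓ² − x Dₓ + (m−n)) u_{m+1,n}·u_{m,n+1} = 0`,
`(Dₓ² − x Dₓ − (2m+n+1)) u_{m,n}·u_{m+1,n} = 0`; consequently the triple
`(τ₀, τ₁, τ₂) = (u_{m,n}, u_{m+1,n}, u_{m,n+1})` satisfies the bilinear form of the
fourth Painlevé equation `(Dₓ² − x Dₓ − (αᵢ − αᵢ₊₁)/3) τᵢ·τᵢ₊₁ = 0` (indices mod 3)
with parameters `(α₀, α₁, α₂) = (3(m + n + 1), −3m, −3n)`. -/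
theorem u_bilinear_P4 (m n : ℕ) :
    (∀ x : ℝ, hirotaFun ((m : ℂ) + 2 * (n : ℂ) + 1) (uFun m (n + 1)) (uFun m n) x = 0) ∧
    (∀ x : ℝ, hirotaFun ((m : ℂ) - (n : ℂ)) (uFun (m + 1) n) (uFun m (n + 1)) x = 0) ∧
    (∀ x : ℝ, hirotaFun (-(2 * (m : ℂ) + (n : ℂ) + 1)) (uFun m n) (uFun (m + 1) n) x = 0) ∧
    ((∀ x : ℝ, hirotaFun
        (-((3 * ((m : ℂ) + (n : ℂ) + 1) - (-(3 * (m : ℂ)))) / 3))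
        (uFun m n) (uFun (m + 1) n) x = 0) ∧
     (∀ x : ℝ, hirotaFun
        (-(((-(3 * (m : ℂ))) - (-(3 * (n : ℂ)))) / 3))
        (uFun (m + 1) n) (uFun m (n + 1)) x = 0) ∧
     (∀ x : ℝ, hirotaFun
        (-(((-(3 * (n : ℂ))) - 3 * ((m : ℂ) + (n : ℂ) + 1)) / 3))
        (uFun m (n + 1)) (uFun m n) x = 0)) := by
  have h1 (x : ℝ) : hirotaFun ((m : ℂ) + 2 * (n : ℂ) + 1) (uFun m (n + 1)) (uFun m n) x = 0 := by
    have h := bilinear_det_p2Rows (Fin.cons 0 fun j : Fin m => (n : ℤ) + 1 + j) Fin.succ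
      (d := m) (by rw [Fin.sum_univ_succ]; simp) (hRect_eq_det m (n + 1))
      (hRect_eq_det_cons m n)
    replace h := congrArg (Polynomial.eval (x : ℂ)) h
    rw [hirotaFun_uFun]
    refine mul_eq_zero_of_right _ ?_
    simp only [Polynomial.eval_add, Polynomial.eval_sub, Polynomial.eval_mul, Polynomial.eval_X,
      Polynomial.eval_ofNat, Polynomial.eval_intCast, Polynomial.eval_zero] at h ⊢
    push_cast at h ⊢
    linear_combination h
  have h2 (x : ℝ) : hirotaFun ((m : ℂ) - (n : ℂ)) (uFun (m + 1) n) (uFun m (n + 1)) x = 0 := by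
    have h := bilinear_det_p2Rows (fun j : Fin (m + 1) => (n : ℤ) + j) Fin.succ
      (d := m - n) (by rw [Fin.sum_univ_succ]; simp; ring) (f := hRect m (n + 1))
      (by
        rw [hRect_eq_det]
        congr 3
        ext j
        push_cast [Fin.val_succ]
        ring)
      (hRect_eq_det (m + 1) n)
    replace h := congrArg (Polynomial.eval (x : ℂ)) h
    rw [hirotaFun_uFun]
    refine mul_eq_zero_of_right _ ?_
    simp only [Polynomial.eval_add, Polynomial.eval_sub, Polynomial.eval_mul, Polynomial.eval_X,
      Polynomial.eval_ofNat, Polynomial.eval_intCast, Polynomial.eval_zero] at h ⊢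
    push_cast at h ⊢
    linear_combination h
  have h3 (x : ℝ) : hirotaFun (-(2 * (m : ℂ) + (n : ℂ) + 1)) (uFun m n) (uFun (m + 1) n) x = 0 := by
    have h := bilinear_det_p2Rows (fun j : Fin (m + 1) => (n : ℤ) + j) Fin.castSucc
      (d := -n) (by rw [Fin.sum_univ_castSucc]; simp) (hRect_eq_det m n)
      (hRect_eq_det (m + 1) n)
    replace h := congrArg (Polynomial.eval (x : ℂ)) h
    rw [hirotaFun_uFun]
    refine mul_eq_zero_of_right _ ?_
    simp only [Polynomial.eval_add, Polynomial.eval_sub, Polynomial.eval_mul, Polynomial.eval_X,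
      Polynomial.eval_ofNat, Polynomial.eval_intCast, Polynomial.eval_zero] at h ⊢
    push_cast at h ⊢
    linear_combination h
  refine ⟨h1, h2, h3, fun x => ?_, fun x => ?_, fun x => ?_⟩
  · convert h3 x using 2
    ring
  · convert h2 x using 2
    ring
  · convert h1 x using 2
    ring
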